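/- arXiv:2211.15277 — 2 statements merged into one kernel-verified Lean document; each statement's English description precedes it below -/
import Mathlib

section
/- Fix n ≥ 2 and 0 ≤ r ≤ n−1, and let F be the set of w ∈ 𝔇_n such that |w_1| < w_2 < w_3 < ⋯ < w_{n−r} with w_2,…,w_{n−r} all positive, and w_{n−r+1} < w_{n−r+2} < ⋯ < w_n. Then Σ_{w∈F} q^{inv_D(w)} = binom(n,r)_q · (1+q^{n−1})(1+q^{n−2})⋯(1+q^{n−r}) = binom(n,r)_q · ∏_{i=1}^{r}(1+q^{n−i}). -/
open Finset

/-- The hyperoctahedral group `𝔅_n`, encoded as (permutation of positions, signs):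
the signed permutation sends `i+1` to `±(σ i + 1)`. -/
abbrev BG (n : ℕ) := Equiv.Perm (Fin n) × (Fin n → Bool)

/-- The value `π_i` (for `1 ≤ i ≤ n`) of the signed permutation, with `π_0 = 0`. -/
def bval {n : ℕ} (w : BG n) (i : ℕ) : ℤ :=
  if h : 1 ≤ i ∧ i ≤ n then
    (if w.2 ⟨i - 1, by omega⟩ then -1 else 1) * (((w.1 ⟨i - 1, by omega⟩ : Fin n) : ℕ) + 1 : ℤ)
  else 0

/-- `edes_B`: even `i ∈ {0,…,n−1}` with `π_i > π_{i+1}`. -/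
def edesB {n : ℕ} (w : BG n) : ℕ :=
  ((range n).filter fun i => Even i ∧ bval w (i + 1) < bval w i).card

/-- `odes_B`: odd `i ∈ {0,…,n−1}` with `π_i > π_{i+1}`. -/
def odesB {n : ℕ} (w : BG n) : ℕ :=
  ((range n).filter fun i => Odd i ∧ bval w (i + 1) < bval w i).card

/-- `easc_B`: even `i ∈ {0,…,n−1}` with `π_i < π_{i+1}`. -/
def eascB {n : ℕ} (w : BG n) : ℕ :=
  ((range n).filter fun i => Even i ∧ bval w i < bval w (i + 1)).card

/-- `oasc_B`: odd `i ∈ {0,…,n−1}` with `π_i < π_{i+1}`. -/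
def oascB {n : ℕ} (w : BG n) : ℕ :=
  ((range n).filter fun i => Odd i ∧ bval w i < bval w (i + 1)).card

/-- type B inversion number -/
def invB {n : ℕ} (w : BG n) : ℕ :=
  ((Icc 1 n ×ˢ Icc 1 n).filter fun p => p.1 < p.2 ∧ bval w p.2 < bval w p.1).card
  + ((Icc 1 n ×ˢ Icc 1 n).filter fun p => p.1 < p.2 ∧ bval w p.2 < -bval w p.1).card
  + ((Icc 1 n).filter fun i => bval w i < 0).card

/-- `B_n(s,t,q)` -/
noncomputable def Bpoly {A : Type*} [CommRing A] (n : ℕ) (s t q : A) : A :=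
  ∑ w : BG n, s ^ edesB w * t ^ odesB w * q ^ invB w

/-- `B_n(1,q)` -/
noncomputable def BOne {A : Type*} [CommRing A] (n : ℕ) (q : A) : A :=
  ∑ w : BG n, q ^ invB w

/-- `[k]_q` -/
def qInt {A : Type*} [CommRing A] (k : ℕ) (q : A) : A := ∑ i ∈ range k, q ^ i

/-- `[k]_q!` -/
def qFact {A : Type*} [CommRing A] (k : ℕ) (q : A) : A := ∏ i ∈ range k, qInt (i + 1) q

/-- number of negative values `π_1,…,π_n` -/
def negs {n : ℕ} (w : BG n) : ℕ := ((Icc 1 n).filter fun i => bval w i < 0).card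

/-- the type D group `𝔇_n` inside `𝔅_n` -/
def DG (n : ℕ) : Finset (BG n) := univ.filter fun w => Even (negs w)

/-- `odes_D`: odd `i ∈ {−1,1,…,n−1}` with `π_i > π_{|i|+1}` (the index `i = −1`
contributes iff `−π_1 > π_2`). -/
def odesD {n : ℕ} (w : BG n) : ℕ :=
  ((Icc 1 (n - 1)).filter fun i => Odd i ∧ bval w (i + 1) < bval w i).card
  + (if bval w 2 < -bval w 1 then 1 else 0)

/-- `edes_D`: even `i ∈ {−1,1,…,n−1}` with `π_i > π_{i+1}`. -/
def edesD {n : ℕ} (w : BG n) : ℕ :=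
  ((Icc 1 (n - 1)).filter fun i => Even i ∧ bval w (i + 1) < bval w i).card

/-- type D inversion number -/
def invD {n : ℕ} (w : BG n) : ℕ :=
  ((Icc 1 n ×ˢ Icc 1 n).filter fun p => p.1 < p.2 ∧ bval w p.2 < bval w p.1).card
  + ((Icc 1 n ×ˢ Icc 1 n).filter fun p => p.1 < p.2 ∧ bval w p.2 < -bval w p.1).card

/-- `D_n(s,t,q)` -/
noncomputable def Dpoly {A : Type*} [CommRing A] (n : ℕ) (s t q : A) : A :=
  ∑ w ∈ DG n, s ^ edesD w * t ^ odesD w * q ^ invD w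

/-- `D_n(1,q)` -/
noncomputable def DOne {A : Type*} [CommRing A] (n : ℕ) (q : A) : A :=
  ∑ w ∈ DG n, q ^ invD w

noncomputable section

/-- the field `ℚ(q)` -/
abbrev Kq : Type := RatFunc ℚ

/-- the variable `q` -/
def qv : Kq := RatFunc.X

/-- the Gaussian binomial coefficient `[n]_q!/([r]_q! [n−r]_q!)` -/
def qBinom (n r : ℕ) (q : Kq) : Kq := qFact n q / (qFact r q * qFact (n - r) q)

/-- The weight of a set `S` of positions in `range n`: `q` to the number of pairs `x < y` with
`x ∈ S`, `y ∉ S`, times a factor `1 + q ^ (x + #{y < x | y ∉ S})` for each `x ∈ S`. -/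
def subsetWeight {A : Type*} [CommRing A] (n : ℕ) (q : A) (S : Finset ℕ) : A :=
  q ^ (∑ x ∈ S, (Ioo x n \ S).card) * ∏ x ∈ S, (1 + q ^ (x + (range x \ S).card))

theorem subsetWeight_succ {A : Type*} [CommRing A] {n : ℕ} (q : A) {S : Finset ℕ}
    (hS : S ⊆ range n) : subsetWeight (n + 1) q S = q ^ S.card * subsetWeight n q S := by
  have h : ∑ x ∈ S, (Ioo x (n + 1) \ S).card = S.card + ∑ x ∈ S, (Ioo x n \ S).card := by
    rw [card_eq_sum_ones, ← sum_add_distrib]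
    refine sum_congr rfl fun x hx => ?_
    have hxn := mem_range.1 (hS hx)
    have hn : n ∉ S := fun h => by simpa using hS h
    have : Ioo x (n + 1) \ S = insert n (Ioo x n \ S) := by
      ext y
      simp only [mem_sdiff, mem_Ioo, mem_insert]
      constructor
      · rintro ⟨h1, h2⟩
        by_cases hy : y = n
        · exact Or.inl hy
        · exact Or.inr ⟨by omega, h2⟩
      · rintro (rfl | ⟨h1, h2⟩)
        · exact ⟨by omega, hn⟩
        · exact ⟨by omega, h2⟩
    rw [this, card_insert_of_notMem (by simp), add_comm]
  rw [subsetWeight, h, pow_add, mul_assoc, subsetWeight]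

theorem subsetWeight_insert {A : Type*} [CommRing A] {n : ℕ} (q : A) {S : Finset ℕ}
    (hS : S ⊆ range n) :
    subsetWeight (n + 1) q (insert n S) = (1 + q ^ (n + (n - S.card))) * subsetWeight n q S := by
  have hn : n ∉ S := fun h => by simpa using hS h
  have h1 : ∀ x ∈ S, Ioo x (n + 1) \ insert n S = Ioo x n \ S := by
    intro x _
    ext y
    simp only [mem_sdiff, mem_Ioo, mem_insert, not_or]
    constructor
    · rintro ⟨h1, h2, h3⟩
      exact ⟨by omega, h3⟩
    · rintro ⟨h1, h2⟩
      exact ⟨by omega, by omega, h2⟩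
  have h2 : ∀ x ≤ n, range x \ insert n S = range x \ S := by
    intro x hx
    ext y
    simp only [mem_sdiff, mem_range, mem_insert, not_or]
    constructor
    · rintro ⟨h1, h2, h3⟩
      exact ⟨h1, h3⟩
    · rintro ⟨h1, h2⟩
      exact ⟨h1, by omega, h2⟩
  have h3 : (range n \ S).card = n - S.card := by
    rw [card_sdiff_of_subset hS, card_range]
  rw [subsetWeight, sum_insert hn, prod_insert hn, h2 n le_rfl, h3,
    sum_congr rfl fun x hx => congrArg card (h1 x hx),
    prod_congr rfl fun x hx => by rw [h2 x (mem_range.1 (hS hx)).le]]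
  have : Ioo n (n + 1) = ∅ := by ext; simp
  rw [this, empty_sdiff, card_empty, zero_add, subsetWeight]
  ring

theorem sum_subsetWeight_succ {A : Type*} [CommRing A] (n r : ℕ) (q : A) :
    ∑ S ∈ powersetCard (r + 1) (range (n + 1)), subsetWeight (n + 1) q S
      = (1 + q ^ (n + (n - r))) * ∑ S ∈ powersetCard r (range n), subsetWeight n q S
        + q ^ (r + 1) * ∑ S ∈ powersetCard (r + 1) (range n), subsetWeight n q S := by
  have hn : ∀ {k : ℕ} {S : Finset ℕ}, S ∈ powersetCard k (range n) → n ∉ S := fun hS h => by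
    simpa using (mem_powersetCard.1 hS).1 h
  rw [range_add_one, powersetCard_succ_insert (by simp), sum_union, sum_image, mul_sum, mul_sum,
    add_comm]
  · congr 1
    · refine sum_congr rfl fun S hS => ?_
      rw [subsetWeight_insert q (mem_powersetCard.1 hS).1, (mem_powersetCard.1 hS).2]
    · refine sum_congr rfl fun S hS => ?_
      rw [subsetWeight_succ q (mem_powersetCard.1 hS).1, (mem_powersetCard.1 hS).2]
  · intro S hS T hT h
    rw [← erase_insert (hn hS), h, erase_insert (hn hT)]
  · rw [disjoint_left]
    rintro S hS hS'
    obtain ⟨T, -, rfl⟩ := mem_image.1 hS'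
    exact hn hS (mem_insert_self _ _)

theorem qInt_add {A : Type*} [CommRing A] (a b : ℕ) (q : A) :
    qInt (a + b) q = qInt a q + q ^ a * qInt b q := by
  simp only [qInt, sum_range_add, pow_add, mul_sum]

theorem qInt_mul_one_sub_pow {A : Type*} [CommRing A] (a b : ℕ) (q : A) :
    qInt a q * (1 - q ^ b) = qInt b q * (1 - q ^ a) := by
  have ha : qInt a q * (q - 1) = q ^ a - 1 := geom_sum_mul q a
  have hb : qInt b q * (q - 1) = q ^ b - 1 := geom_sum_mul q b
  linear_combination qInt a q * hb - qInt b q * ha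

theorem qInt_mul_one_add_pow {A : Type*} [CommRing A] (m r : ℕ) (q : A) :
    qInt (r + 1 + (m + 1)) q * (1 + q ^ (m + 1 + r))
      = (1 + q ^ (m + 1 + r + (m + 1))) * qInt (r + 1) q
        + q ^ (r + 1) * qInt (m + 1) q * (1 + q ^ m) := by
  rw [qInt_add]
  linear_combination q ^ (m + 1 + r) * qInt_mul_one_sub_pow (r + 1) (m + 1) q

theorem qFact_succ {A : Type*} [CommRing A] (k : ℕ) (q : A) :
    qFact (k + 1) q = qFact k q * qInt (k + 1) q := prod_range_succ _ _

theorem sum_subsetWeight_mul_qFact {A : Type*} [CommRing A] (q : A) (n r : ℕ) (hr : r ≤ n) :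
    (∑ S ∈ powersetCard r (range n), subsetWeight n q S) * (qFact r q * qFact (n - r) q)
      = qFact n q * ∏ i ∈ range r, (1 + q ^ (n - (i + 1))) := by
  induction n generalizing r with
  | zero =>
    obtain rfl : r = 0 := by omega
    simp [subsetWeight, qFact]
  | succ n ih =>
    cases r with
    | zero => simp [subsetWeight, qFact]
    | succ r =>
      have h1 := ih r (by omega)
      rw [sum_subsetWeight_succ, prod_range_succ' (fun i => 1 + q ^ (n + 1 - (i + 1)))]
      simp only [Nat.add_sub_add_right, zero_add, Nat.add_sub_cancel]
      rw [qFact_succ r, qFact_succ n]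
      obtain ⟨m, rfl⟩ := Nat.exists_eq_add_of_le (show r ≤ n by omega)
      rw [Nat.add_sub_cancel_left] at h1 ⊢
      cases m with
      | zero =>
        simp only [add_zero] at h1 ⊢
        rw [powersetCard_eq_empty.2 (show (range r).card < r + 1 by simp), sum_empty, mul_zero,
          add_zero]
        linear_combination ((1 + q ^ r) * qInt (r + 1) q) * h1
      | succ m =>
        have h2 := ih (r + 1) (by omega)
        rw [prod_range_succ, qFact_succ r, show r + (m + 1) - (r + 1) = m by omega] at h2
        rw [qFact_succ m] at h1 ⊢
        have h3 := qInt_mul_one_add_pow m r q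
        rw [show r + 1 + (m + 1) = r + (m + 1) + 1 by ring,
          show m + 1 + r = r + (m + 1) by ring] at h3
        linear_combination (1 + q ^ (r + (m + 1) + (m + 1))) * qInt (r + 1) q * h1
          + q ^ (r + 1) * qInt (m + 1) q * h2
          - qFact (r + (m + 1)) q * (∏ i ∈ range r, (1 + q ^ (r + (m + 1) - (i + 1)))) * h3

theorem qInt_qv_ne_zero (k : ℕ) : qInt (k + 1) qv ≠ 0 := by
  have h : qInt (k + 1) qv
      = algebraMap (Polynomial ℚ) Kq (∑ i ∈ range (k + 1), Polynomial.X ^ i) := by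
    simp [qInt, qv, map_sum, RatFunc.algebraMap_X]
  rw [h]
  refine RatFunc.algebraMap_ne_zero fun h0 => ?_
  have h1 := congrArg (Polynomial.eval 1) h0
  simp only [Polynomial.eval_finsetSum, Polynomial.eval_pow, Polynomial.eval_X, one_pow, sum_const,
    card_range, nsmul_eq_mul, mul_one, Polynomial.eval_zero] at h1
  exact Nat.cast_ne_zero.2 k.succ_ne_zero h1

theorem qFact_qv_ne_zero (k : ℕ) : qFact k qv ≠ 0 :=
  prod_ne_zero_iff.2 fun i _ => qInt_qv_ne_zero i

/-- `sgnVal w i` is the value of `w` at the `i`-th position, positions being counted from `0`. -/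
def sgnVal {n : ℕ} (w : BG n) (i : Fin n) : ℤ :=
  if w.2 i then -((w.1 i : ℕ) + 1 : ℤ) else ((w.1 i : ℕ) + 1 : ℤ)

theorem bval_succ {n : ℕ} (w : BG n) (i : Fin n) : bval w (i + 1) = sgnVal w i := by
  have h : 1 ≤ (i : ℕ) + 1 ∧ (i : ℕ) + 1 ≤ n := ⟨by omega, i.2⟩
  simp only [bval, h, and_self, dif_pos, Nat.add_sub_cancel, Fin.eta, sgnVal]
  split_ifs <;> ring

theorem abs_sgnVal {n : ℕ} (w : BG n) (i : Fin n) : |sgnVal w i| = (w.1 i : ℕ) + 1 := by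
  unfold sgnVal
  split_ifs
  · rw [abs_neg, abs_of_nonneg (by positivity)]
  · rw [abs_of_nonneg (by positivity)]

theorem sgnVal_neg {n : ℕ} (w : BG n) (i : Fin n) : sgnVal w i < 0 ↔ w.2 i = true := by
  unfold sgnVal
  split_ifs with h <;> simp only [h] <;> simp <;> omega

/-- The first `m` values of `w` have increasing absolute values and are positive except possibly
the first one, and the remaining values are increasing. -/
def IsTwoRun {n : ℕ} (m : ℕ) (w : BG n) : Prop :=
  (∀ i : Fin n, 0 < (i : ℕ) → (i : ℕ) < m → w.2 i = false) ∧
  (∀ i j : Fin n, i < j → (j : ℕ) < m → w.1 i < w.1 j) ∧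
  (∀ i j : Fin n, m ≤ (i : ℕ) → i < j → sgnVal w i < sgnVal w j)

theorem lt_of_forall_lt_succ {f : ℕ → ℤ} {a b : ℕ} (h : ∀ j, a ≤ j → j < b → f j < f (j + 1))
    {i j : ℕ} (hi : a ≤ i) (hij : i < j) (hj : j ≤ b) : f i < f j := by
  induction j, hij using Nat.le_induction with
  | base => exact h i hi (by omega)
  | succ j hij ih => exact (ih (by omega)).trans (h j (by omega) (by omega))

theorem isTwoRun_iff {n m : ℕ} (hm : m ≤ n) (w : BG n) :
    ((∀ j : ℕ, 2 ≤ j → j ≤ m → 0 < bval w j) ∧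
        (2 ≤ m → |bval w 1| < bval w 2) ∧
        (∀ j : ℕ, 2 ≤ j → j < m → bval w j < bval w (j + 1)) ∧
        (∀ j : ℕ, m + 1 ≤ j → j < n → bval w j < bval w (j + 1))) ↔ IsTwoRun m w := by
  constructor
  · rintro ⟨h1, h2, h3, h4⟩
    refine ⟨fun i hi him => ?_, fun i j hij hj => ?_, fun i j hi hij => ?_⟩
    · have := h1 (i + 1) (by omega) (by omega)
      rw [bval_succ] at this
      by_contra hc
      have := (sgnVal_neg w i).2 (by simpa using hc)
      omega
    · have h : ∀ j, 1 ≤ j → j < m → |bval w j| < |bval w (j + 1)| := by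
        intro j hj hjm
        rcases hj.eq_or_lt with rfl | hj
        · exact (h2 (by omega)).trans_le (le_abs_self _)
        · rw [abs_of_pos (h1 j hj hjm.le), abs_of_pos (h1 (j + 1) (by omega) (by omega))]
          exact h3 j hj hjm
      have := lt_of_forall_lt_succ h (i := i + 1) (j := j + 1) (by omega)
        (by simpa using hij) (by omega)
      rw [bval_succ, bval_succ, abs_sgnVal, abs_sgnVal] at this
      rw [Fin.lt_def]
      omega
    · have := lt_of_forall_lt_succ h4 (i := i + 1) (j := j + 1) (by omega)
        (by simpa using hij) (by omega)
      rwa [bval_succ, bval_succ] at this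
  · rintro ⟨h1, h2, h3⟩
    have hpos : ∀ j : Fin n, 0 < (j : ℕ) → (j : ℕ) < m → sgnVal w j = (w.1 j : ℕ) + 1 := by
      intro j hj hjm
      simp [sgnVal, h1 j hj hjm]
    refine ⟨fun j hj hjm => ?_, fun hm2 => ?_, fun j hj hjm => ?_, fun j hj hjn => ?_⟩
    · obtain ⟨k, rfl⟩ : ∃ k, j = k + 1 := ⟨j - 1, by omega⟩
      rw [bval_succ w ⟨k, by omega⟩, hpos ⟨k, by omega⟩ (by simp; omega) (by simp; omega)]
      positivity
    · have := h2 ⟨0, by omega⟩ ⟨1, by omega⟩ (by simp) (by simp; omega)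
      rw [bval_succ w ⟨0, by omega⟩, bval_succ w ⟨1, by omega⟩, abs_sgnVal,
        hpos ⟨1, by omega⟩ (by simp) (by simp; omega)]
      rw [Fin.lt_def] at this
      omega
    · obtain ⟨k, rfl⟩ : ∃ k, j = k + 1 := ⟨j - 1, by omega⟩
      have := h2 ⟨k, by omega⟩ ⟨k + 1, by omega⟩ (by simp) (by simp; omega)
      rw [bval_succ w ⟨k, by omega⟩, bval_succ w ⟨k + 1, by omega⟩,
        hpos ⟨k, by omega⟩ (by simp; omega) (by simp; omega),
        hpos ⟨k + 1, by omega⟩ (by simp) (by simp; omega)]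
      rw [Fin.lt_def] at this
      omega
    · obtain ⟨k, rfl⟩ : ∃ k, j = k + 1 := ⟨j - 1, by omega⟩
      rw [bval_succ w ⟨k, by omega⟩, bval_succ w ⟨k + 1, by omega⟩]
      exact h3 _ _ (by simp; omega) (by simp)

/-- The absolute values (minus one) of the values of `w` beyond the first `m` positions. -/
def tailAbs {n : ℕ} (m : ℕ) (w : BG n) : Finset ℕ :=
  (univ.filter fun i : Fin n => m ≤ (i : ℕ)).image fun i => (w.1 i : ℕ)

/-- The absolute values (minus one) of the negative values of `w` beyond the first `m`
positions. -/
def tailNeg {n : ℕ} (m : ℕ) (w : BG n) : Finset ℕ :=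
  (univ.filter fun i : Fin n => m ≤ (i : ℕ) ∧ w.2 i = true).image fun i => (w.1 i : ℕ)

theorem mem_tailAbs {n m : ℕ} (w : BG n) (i : Fin n) : (w.1 i : ℕ) ∈ tailAbs m w ↔ m ≤ (i : ℕ) := by
  simp [tailAbs, Fin.val_inj]

theorem mem_tailNeg {n m : ℕ} (w : BG n) (i : Fin n) :
    (w.1 i : ℕ) ∈ tailNeg m w ↔ m ≤ (i : ℕ) ∧ w.2 i = true := by
  simp [tailNeg, Fin.val_inj]

theorem tailNeg_subset {n m : ℕ} (w : BG n) : tailNeg m w ⊆ tailAbs m w :=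
  image_subset_image fun i => by simp +contextual

theorem tailAbs_subset {n m : ℕ} (w : BG n) : tailAbs m w ⊆ range n := by
  simp [tailAbs, image_subset_iff]

theorem card_tailAbs {n m : ℕ} (w : BG n) : (tailAbs m w).card = n - m := by
  rw [tailAbs, card_image_of_injective (f := fun i => (w.1 i : ℕ)) _
    (Fin.val_injective.comp w.1.injective)]
  rw [← card_map Fin.valEmbedding, show (univ.filter fun i : Fin n => m ≤ (i : ℕ)).map
    Fin.valEmbedding = Ico m n by
      ext x
      simp only [mem_map, mem_filter, mem_univ, true_and, Fin.valEmbedding_apply, mem_Ico]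
      exact ⟨by rintro ⟨i, hi, rfl⟩; exact ⟨hi, i.2⟩, fun h => ⟨⟨x, h.2⟩, h.1, rfl⟩⟩,
    Nat.card_Ico]

/-- The exponent of `q` contributed by a set `S` of absolute values and its subset `N` of
negative ones. -/
def pairWeight (n : ℕ) (S N : Finset ℕ) : ℕ :=
  ∑ x ∈ S, (Ioo x n \ S).card + ∑ x ∈ N, (x + (range x \ S).card)

theorem sum_pairWeight {A : Type*} [CommRing A] (n : ℕ) (q : A) (S : Finset ℕ) :
    ∑ N ∈ S.powerset, q ^ pairWeight n S N = subsetWeight n q S := by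
  rw [subsetWeight, prod_one_add, mul_sum]
  exact sum_congr rfl fun N _ => by rw [pairWeight, pow_add, prod_pow_eq_pow_sum]

/-- The contribution of the pair `(x, y)` to `pairWeight`. -/
def pairTerm (S N : Finset ℕ) (x y : ℕ) : ℕ :=
  (if x ∈ S ∧ y ∉ S ∧ x < y then 1 else 0)
    + (if x ∈ N ∧ y < x then 1 + (if y ∉ S then 1 else 0) else 0)

theorem pairWeight_eq_sum_pairTerm {n : ℕ} {S N : Finset ℕ} (hS : S ⊆ range n) (hN : N ⊆ S) :
    pairWeight n S N = ∑ x ∈ range n, ∑ y ∈ range n, pairTerm S N x y := by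
  simp only [pairTerm, sum_add_distrib (s := range n)]
  rw [pairWeight]
  congr 1
  · refine Eq.trans (sum_congr rfl fun x hx => ?_) (sum_subset hS fun x _ hx => by simp [hx])
    rw [← card_filter]
    congr 1
    ext y
    simp only [mem_sdiff, mem_Ioo, mem_filter, mem_range, hx, true_and]
    tauto
  · refine Eq.trans (sum_congr rfl fun x hx => ?_)
      (sum_subset (hN.trans hS) fun x _ hx => by simp [hx])
    have hxn := mem_range.1 (hS (hN hx))
    have h : (range n).filter (fun y => y < x) = range x := by
      ext y
      simp only [mem_filter, mem_range]
      omega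
    simp only [hx, true_and]
    rw [← sum_filter, h, sum_add_distrib, ← card_filter, filter_notMem_eq_sdiff]
    simp

theorem sum_sum_eq_sum_lt {n : ℕ} (f : Fin n → Fin n → ℕ) (hf : ∀ i, f i i = 0) :
    ∑ i, ∑ j, f i j = ∑ i, ∑ j, if i < j then f i j + f j i else 0 := by
  have h : ∀ i j, f i j = (if i < j then f i j else 0) + (if j < i then f i j else 0) := by
    intro i j
    rcases lt_trichotomy i j with h | rfl | h
    · simp [h, h.le]
    · simp [hf]
    · simp [h, h.le]
  calc _ = ∑ i, ∑ j, ((if i < j then f i j else 0) + (if j < i then f i j else 0)) :=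
        sum_congr rfl fun i _ => sum_congr rfl fun j _ => h i j
    _ = ∑ i, ∑ j, (if i < j then f i j else 0) + ∑ i, ∑ j, (if i < j then f j i else 0) := by
        simp only [sum_add_distrib]
        rw [sum_comm (f := fun i j => if j < i then f i j else 0)]
    _ = _ := by
        simp only [← sum_add_distrib]
        refine sum_congr rfl fun i _ => sum_congr rfl fun j _ => ?_
        split_ifs <;> simp

theorem sum_Icc_one_eq_sum_fin (n : ℕ) (f : ℕ → ℕ) :
    ∑ i ∈ Icc 1 n, f i = ∑ i : Fin n, f (i + 1) := by
  rw [Fin.sum_univ_eq_sum_range fun i => f (i + 1), range_eq_Ico, sum_Ico_add' f 0 n 1]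
  rfl

theorem invD_eq_sum {n : ℕ} (w : BG n) :
    invD w = ∑ i : Fin n, ∑ j : Fin n, if i < j then
      (if sgnVal w j < sgnVal w i then 1 else 0) + (if sgnVal w j < -sgnVal w i then 1 else 0)
      else 0 := by
  rw [invD, card_filter, card_filter, ← sum_add_distrib, sum_product, sum_Icc_one_eq_sum_fin]
  refine sum_congr rfl fun i _ => ?_
  rw [sum_Icc_one_eq_sum_fin]
  refine sum_congr rfl fun j _ => ?_
  simp only [bval_succ, Fin.lt_def]
  by_cases h : (i : ℕ) < j <;> simp [h]

theorem invD_eq_pairWeight {n m : ℕ} (w : BG n) (hw : IsTwoRun m w) :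
    invD w = pairWeight n (tailAbs m w) (tailNeg m w) := by
  rw [pairWeight_eq_sum_pairTerm (tailAbs_subset w) (tailNeg_subset w), invD_eq_sum]
  have hsum : ∀ f : ℕ → ℕ, ∑ x ∈ range n, f x = ∑ i, f (w.1 i) := fun f => by
    rw [← Fin.sum_univ_eq_sum_range, Equiv.sum_comp w.1 fun i => f i]
  simp only [hsum]
  refine Eq.trans (sum_congr rfl fun i _ => sum_congr rfl fun j _ => ?_) (sum_sum_eq_sum_lt
    (fun i j => pairTerm (tailAbs m w) (tailNeg m w) (w.1 i) (w.1 j)) fun i => by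
      simp [pairTerm]).symm
  by_cases hij : i < j
  swap
  · rw [if_neg hij, if_neg hij]
  rw [if_pos hij, if_pos hij]
  obtain ⟨h1, h2, h3⟩ := hw
  have hne : (w.1 i : ℕ) ≠ w.1 j := fun h => hij.ne (w.1.injective (Fin.ext h))
  have h1 := h1 j (by rw [Fin.lt_def] at hij; omega)
  have h2 := h2 i j hij
  have h3 := fun h => h3 i j h hij
  simp only [pairTerm, mem_tailAbs, mem_tailNeg]
  rw [Fin.lt_def] at h2 hij
  simp only [sgnVal] at h3 ⊢
  by_cases hi : m ≤ (i : ℕ)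
  · have hj : m ≤ (j : ℕ) := by omega
    have h3 := h3 hi
    simp only [hi, hj, true_and, not_true, false_and, and_false, if_false]
    by_cases hsi : w.2 i = true <;> by_cases hsj : w.2 j = true <;>
      simp only [hsi, hsj, if_true, Bool.false_eq_true, if_false, true_and, false_and] at h3 ⊢ <;>
      split_ifs <;> omega
  · by_cases hj : m ≤ (j : ℕ)
    · simp only [hi, hj, true_and, not_true, not_false_iff, false_and, and_false, if_false, if_true]
      by_cases hsi : w.2 i = true <;> by_cases hsj : w.2 j = true <;>
        simp only [hsi, hsj, if_true, Bool.false_eq_true, if_false, true_and, false_and] <;>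
        split_ifs <;> omega
    · have h1 := h1 (by omega)
      have h2 := h2 (by omega)
      simp only [hi, hj, h1, not_false_iff, false_and, if_false, Bool.false_eq_true]
      by_cases hsi : w.2 i = true <;>
        simp only [hsi, if_true, Bool.false_eq_true, if_false] <;>
        split_ifs <;> omega

/-- An injective key on absolute values. The one-line form of an element satisfying
`IsTwoRun` with tail data `S`, `N` lists the absolute values in increasing order of their keys. -/
def runKey (n : ℕ) (S N : Finset ℕ) (a : Fin n) : ℤ :=
  if (a : ℕ) ∈ N then -((a : ℕ) + 1 : ℤ) else if (a : ℕ) ∈ S then (a : ℕ) + 1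
    else (a : ℕ) - 2 * n

theorem runKey_injective (n : ℕ) (S N : Finset ℕ) : Function.Injective (runKey n S N) := by
  intro a b h
  have ha := a.2
  have hb := b.2
  rw [Fin.ext_iff]
  unfold runKey at h
  split_ifs at h <;> omega

theorem strictMono_runKey {n m : ℕ} {w : BG n} (hw : IsTwoRun m w) :
    StrictMono (runKey n (tailAbs m w) (tailNeg m w) ∘ w.1) := by
  intro i j hij
  have hi := (w.1 i).2
  have hj := (w.1 j).2
  obtain ⟨-, h2, h3⟩ := hw
  have h2 := h2 i j hij
  have h3 := fun h => h3 i j h hij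
  rw [Fin.lt_def] at h2 hij
  simp only [Function.comp, runKey, mem_tailAbs, mem_tailNeg]
  simp only [sgnVal] at h3
  split_ifs at h3 ⊢ <;> simp_all <;> omega

theorem eq_of_strictMono_comp {n : ℕ} {f : Fin n → ℤ} (hf : Function.Injective f)
    {σ τ : Equiv.Perm (Fin n)} (hσ : StrictMono (f ∘ σ)) (hτ : StrictMono (f ∘ τ)) : σ = τ :=
  Equiv.ext fun i => hf (congrFun (Tuple.unique_monotone hσ.monotone hτ.monotone) i)

theorem negs_eq {n : ℕ} (w : BG n) : negs w = (univ.filter fun i : Fin n => w.2 i = true).card := by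
  rw [negs, card_filter, card_filter, sum_Icc_one_eq_sum_fin]
  simp only [bval_succ, sgnVal_neg]

theorem card_tailNeg {n m : ℕ} (w : BG n) :
    (tailNeg m w).card = (univ.filter fun i : Fin n => m ≤ (i : ℕ) ∧ w.2 i = true).card := by
  rw [tailNeg, card_image_of_injective (f := fun i => (w.1 i : ℕ)) _
    (Fin.val_injective.comp w.1.injective)]

theorem negs_eq_card_tailNeg_add {n m : ℕ} (hm : 0 < m) (hn : 0 < n) (w : BG n)
    (hw : ∀ i : Fin n, 0 < (i : ℕ) → (i : ℕ) < m → w.2 i = false) :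
    negs w = (tailNeg m w).card + if w.2 ⟨0, hn⟩ = true then 1 else 0 := by
  rw [negs_eq, card_tailNeg]
  split_ifs with h
  · rw [← card_insert_of_notMem (a := (⟨0, hn⟩ : Fin n)) (by simp; omega)]
    congr 1
    ext i
    simp only [mem_filter, mem_univ, true_and, mem_insert, Fin.ext_iff]
    constructor
    · intro hi
      by_contra hc
      have := hw i (by omega) (by by_contra; exact hc (Or.inr ⟨by omega, hi⟩))
      simp_all
    · rintro (h0 | h0)
      · rwa [show i = ⟨0, hn⟩ from Fin.ext h0]
      · exact h0.2
  · rw [add_zero]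
    congr 1
    ext i
    simp only [mem_filter, mem_univ, true_and]
    refine ⟨fun hi => ⟨?_, hi⟩, And.right⟩
    by_contra hc
    rcases Nat.eq_zero_or_pos (i : ℕ) with h0 | h0
    · rw [show i = ⟨0, hn⟩ from Fin.ext h0] at hi
      exact h hi
    · have := hw i h0 (by omega)
      simp_all

theorem eq_of_tail_eq {n m : ℕ} (hm : 0 < m) (hn : 0 < n) {v w : BG n} (hv : IsTwoRun m v)
    (hw : IsTwoRun m w) (hve : Even (negs v)) (hwe : Even (negs w))
    (hS : tailAbs m v = tailAbs m w) (hN : tailNeg m v = tailNeg m w) : v = w := by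
  have hσ : v.1 = w.1 := by
    refine eq_of_strictMono_comp (runKey_injective n (tailAbs m v) (tailNeg m v))
      (strictMono_runKey hv) ?_
    rw [hS, hN]
    exact strictMono_runKey hw
  refine Prod.ext hσ (funext fun i => ?_)
  by_cases hi : m ≤ (i : ℕ)
  · have h1 := mem_tailNeg (m := m) v i
    have h2 := mem_tailNeg (m := m) w i
    rw [hσ, hN] at h1
    simp only [hi, true_and] at h1 h2
    exact Bool.eq_iff_iff.2 (h1.symm.trans h2)
  · rcases Nat.eq_zero_or_pos (i : ℕ) with h0 | h0
    · rw [negs_eq_card_tailNeg_add hm hn v hv.1] at hve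
      rw [negs_eq_card_tailNeg_add hm hn w hw.1, ← hN] at hwe
      rw [show i = ⟨0, hn⟩ from Fin.ext h0]
      cases h1 : v.2 ⟨0, hn⟩ <;> cases h2 : w.2 ⟨0, hn⟩ <;>
        simp_all [Nat.even_add_one, ← Nat.not_even_iff_odd]
    · rw [hv.1 i h0 (by omega), hw.1 i h0 (by omega)]

theorem mem_iff_lt_card_of_isLowerSet {n : ℕ} (T : Finset (Fin n))
    (hT : ∀ i j : Fin n, i < j → j ∈ T → i ∈ T) (i : Fin n) : i ∈ T ↔ (i : ℕ) < T.card := by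
  constructor
  · intro hi
    have : Iic i ⊆ T := fun j hj => (mem_Iic.1 hj).eq_or_lt.elim (fun h => h ▸ hi)
      fun h => hT j i h hi
    have := card_le_card this
    rw [Fin.card_Iic] at this
    omega
  · intro hi
    by_contra hc
    have : T ⊆ Iio i := fun j hj => by
      rw [mem_Iio]
      by_contra h
      rcases (not_lt.1 h).eq_or_lt with h | h
      · exact hc (h ▸ hj)
      · exact hc (hT i j h hj)
    have := card_le_card this
    rw [Fin.card_Iio] at this
    omega

theorem exists_isTwoRun {n r : ℕ} (hr : r < n) {S N : Finset ℕ} (hS : S ⊆ range n)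
    (hSr : S.card = r) (hN : N ⊆ S) :
    ∃ w : BG n, IsTwoRun (n - r) w ∧ Even (negs w) ∧ tailAbs (n - r) w = S ∧
      tailNeg (n - r) w = N := by
  obtain ⟨σ, hσ⟩ : ∃ σ : Equiv.Perm (Fin n), StrictMono (runKey n S N ∘ σ) :=
    ⟨Tuple.sort (runKey n S N), (Tuple.monotone_sort _).strictMono_of_injective
      ((runKey_injective n S N).comp (Equiv.injective _))⟩
  have hcard : (univ.filter fun i : Fin n => (σ i : ℕ) ∉ S).card = n - r := by
    have h : ∑ i : Fin n, (if (i : ℕ) ∉ S then 1 else 0) = n - r := by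
      rw [Fin.sum_univ_eq_sum_range fun i => if i ∉ S then 1 else 0, ← card_filter,
        filter_notMem_eq_sdiff, card_sdiff_of_subset hS, card_range, hSr]
    rw [card_filter, ← h]
    exact Equiv.sum_comp σ fun i => if (i : ℕ) ∉ S then 1 else 0
  have hmem : ∀ i : Fin n, (σ i : ℕ) ∈ S ↔ n - r ≤ (i : ℕ) := by
    intro i
    have := mem_iff_lt_card_of_isLowerSet (univ.filter fun i : Fin n => (σ i : ℕ) ∉ S) (by
      intro i j hij hj
      have hlt := hσ hij
      have hi := (σ i).2
      have hj' := (σ j).2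
      simp only [mem_filter, mem_univ, true_and] at hj ⊢
      intro hiS
      have hjN : (σ j : ℕ) ∉ N := fun h => hj (hN h)
      simp only [Function.comp, runKey, hj, hiS, hjN, if_true, if_false] at hlt
      split_ifs at hlt <;> omega) i
    rw [hcard] at this
    simp only [mem_filter, mem_univ, true_and] at this
    rw [← not_iff_not, this, not_le]
  let w : BG n := (σ, fun i => if (i : ℕ) = 0 then decide (Odd N.card) else decide ((σ i : ℕ) ∈ N))
  have hw2 : ∀ i : Fin n, 0 < (i : ℕ) → (w.2 i = true ↔ (σ i : ℕ) ∈ N) := by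
    intro i hi
    simp [w, hi.ne']
  have hfalse : ∀ i : Fin n, 0 < (i : ℕ) → (i : ℕ) < n - r → w.2 i = false := by
    intro i hi him
    rw [← Bool.not_eq_true, hw2 i hi]
    exact fun h => by have := (hmem i).1 (hN h); omega
  have hext : ∀ T U : Finset ℕ, T ⊆ range n → U ⊆ range n →
      (∀ i : Fin n, (σ i : ℕ) ∈ T ↔ (σ i : ℕ) ∈ U) → T = U := by
    intro T U hT hU h
    have h' : ∀ x < n, (x ∈ T ↔ x ∈ U) := fun x hx => by
      simpa using h (σ.symm ⟨x, hx⟩)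
    ext x
    exact ⟨fun hx => (h' x (mem_range.1 (hT hx))).1 hx, fun hx => (h' x (mem_range.1 (hU hx))).2 hx⟩
  have hSw : tailAbs (n - r) w = S := hext _ _ (tailAbs_subset w) hS fun i => by
    rw [hmem]
    exact mem_tailAbs w i
  have hNw : tailNeg (n - r) w = N :=
    hext _ _ ((tailNeg_subset w).trans (tailAbs_subset w)) (hN.trans hS) fun i => by
      refine (mem_tailNeg w i).trans ⟨fun h => (hw2 i (by omega)).1 h.2, fun h => ?_⟩
      have hi := (hmem i).1 (hN h)
      exact ⟨hi, (hw2 i (by omega)).2 h⟩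
  refine ⟨w, ⟨hfalse, fun i j hij hj => ?_, fun i j hi hij => ?_⟩, ?_, hSw, hNw⟩
  · have hlt := hσ hij
    have hjS : (σ j : ℕ) ∉ S := fun h => by have := (hmem j).1 h; omega
    have hiS : (σ i : ℕ) ∉ S := fun h => by
      have := (hmem i).1 h
      rw [Fin.lt_def] at hij
      omega
    have hjN : (σ j : ℕ) ∉ N := fun h => hjS (hN h)
    have hiN : (σ i : ℕ) ∉ N := fun h => hiS (hN h)
    simp only [Function.comp, runKey, hiS, hjS, hiN, hjN, if_false] at hlt
    change σ i < σ j
    rw [Fin.lt_def]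
    omega
  · have key : ∀ k : Fin n, n - r ≤ (k : ℕ) → sgnVal w k = runKey n S N (σ k) := by
      intro k hk
      have hkS := (hmem k).2 hk
      have := hw2 k (by omega)
      simp only [sgnVal, runKey, this, hkS, if_true]
      rfl
    rw [key i hi, key j (by rw [Fin.lt_def] at hij; omega)]
    exact hσ hij
  · rw [negs_eq_card_tailNeg_add (m := n - r) (by omega) (by omega) w hfalse, hNw]
    by_cases h : Odd N.card
    · simp [w, h]
    · simpa only [w, h, decide_false, if_true, Bool.false_eq_true, if_false, add_zero] using
        Nat.not_odd_iff_even.1 h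

theorem inv_typeD_over_increasing_runs (n r : ℕ) (hn : 2 ≤ n) (hr : r ≤ n - 1) :
    ∑ w ∈ ((DG n).filter fun w : BG n =>
        (∀ j : ℕ, 2 ≤ j → j ≤ n - r → 0 < bval w j) ∧
        (2 ≤ n - r → |bval w 1| < bval w 2) ∧
        (∀ j : ℕ, 2 ≤ j → j < n - r → bval w j < bval w (j + 1)) ∧
        (∀ j : ℕ, n - r + 1 ≤ j → j < n → bval w j < bval w (j + 1))),
      qv ^ invD w
    = qBinom n r qv * ∏ i ∈ Icc 1 r, (1 + qv ^ (n - i)) := by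
  set m := n - r with hm
  have hdata : ∀ w : BG n, w ∈ (DG n).filter (fun w : BG n =>
        (∀ j : ℕ, 2 ≤ j → j ≤ m → 0 < bval w j) ∧
        (2 ≤ m → |bval w 1| < bval w 2) ∧
        (∀ j : ℕ, 2 ≤ j → j < m → bval w j < bval w (j + 1)) ∧
        (∀ j : ℕ, m + 1 ≤ j → j < n → bval w j < bval w (j + 1)))
      ↔ Even (negs w) ∧ IsTwoRun m w := by
    intro w
    rw [mem_filter, isTwoRun_iff (by omega), DG, mem_filter]
    simp
  have hsum : ∑ S ∈ powersetCard r (range n), subsetWeight n qv S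
      = qBinom n r qv * ∏ i ∈ Icc 1 r, (1 + qv ^ (n - i)) := by
    have h := sum_subsetWeight_mul_qFact qv n r (by omega)
    have hprod : ∏ i ∈ Icc 1 r, (1 + qv ^ (n - i)) = ∏ i ∈ range r, (1 + qv ^ (n - (i + 1))) := by
      rw [range_eq_Ico, prod_Ico_add' (fun i => 1 + qv ^ (n - i)) 0 r 1]
      rfl
    rw [hprod, qBinom, div_mul_eq_mul_div, eq_div_iff
      (mul_ne_zero (qFact_qv_ne_zero _) (qFact_qv_ne_zero _)), h]
  rw [← hsum, sum_congr rfl fun S _ => (sum_pairWeight n qv S).symm, sum_sigma']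
  refine sum_bij (fun w _ => ⟨tailAbs m w, tailNeg m w⟩) ?_ ?_ ?_ ?_
  · intro w _
    rw [mem_sigma, mem_powersetCard, mem_powerset]
    exact ⟨⟨tailAbs_subset w, by rw [card_tailAbs]; omega⟩, tailNeg_subset w⟩
  · intro v hv w hw h
    obtain ⟨hve, hv⟩ := (hdata v).1 hv
    obtain ⟨hwe, hw⟩ := (hdata w).1 hw
    simp only [Sigma.mk.injEq, heq_eq_eq] at h
    exact eq_of_tail_eq (by omega) (by omega) hv hw hve hwe h.1 h.2
  · rintro ⟨S, N⟩ h
    rw [mem_sigma, mem_powersetCard, mem_powerset] at h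
    obtain ⟨w, hw, hwe, hwS, hwN⟩ := exists_isTwoRun (by omega) h.1.1 h.1.2 h.2
    exact ⟨w, (hdata w).2 ⟨hwe, hw⟩, by rw [hwS, hwN]⟩
  · intro w hw
    rw [invD_eq_pairWeight w ((hdata w).1 hw).2]

end
end

section
/- For 1 ≤ i ≤ n−1 let H_{n,i} = {π ∈ 𝔇_n : π_{i+1} < π_{i+2} < ⋯ < π_n}, and write W(S) = Σ_{π∈S} t^{odes_D(π)} s^{edes_D(π)} q^{inv_D(π)}. If 2 ≤ i ≤ n−1 is odd then D_i(1,q)·[n−i]_q!·W(H_{n,i}) = t·D_i(s,t,q)·D_n(1,q) + (1−t)·D_i(1,q)·[n−i]_q!·W(H_{n,i−1}), and if 2 ≤ i ≤ n−1 is even then D_i(1,q)·[n−i]_q!·W(H_{n,i}) = s·D_i(s,t,q)·D_n(1,q) + (1−s)·D_i(1,q)·[n−i]_q!·W(H_{n,i−1}) (identities of polynomials in s, t, q). -/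
open Finset

noncomputable section

/-- the field `ℚ(q,s,t)` -/
abbrev K : Type := FractionRing (MvPolynomial (Fin 3) ℚ)

def qK : K := algebraMap (MvPolynomial (Fin 3) ℚ) K (MvPolynomial.X 0)
def sK : K := algebraMap (MvPolynomial (Fin 3) ℚ) K (MvPolynomial.X 1)
def tK : K := algebraMap (MvPolynomial (Fin 3) ℚ) K (MvPolynomial.X 2)

/-- the ring `R = ℚ(q,s,t)[M]/(M² − (1−s)(1−t))` -/
abbrev R : Type := AdjoinRoot ((Polynomial.X : Polynomial K) ^ 2
  - Polynomial.C ((1 - sK) * (1 - tK)))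

/-- the square root `M` of `(1−s)(1−t)` -/
def M : R := AdjoinRoot.root _

def ofK : K →+* R := algebraMap K R

/-- `H_{n,i}`: elements of `𝔇_n` whose last `n − i` entries increase. -/
def Hset (n i : ℕ) : Finset (BG n) :=
  (DG n).filter fun w => ∀ j : ℕ, j < n → i + 1 ≤ j → bval w j < bval w (j + 1)

/-- `W(S) = Σ_{π∈S} t^{odes_D} s^{edes_D} q^{inv_D}` -/
def W {n : ℕ} (S : Finset (BG n)) : K :=
  ∑ w ∈ S, tK ^ odesD w * sK ^ edesD w * qK ^ invD w

section OrderStatistics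

/-- `inv_D` of a sequence `f 1, …, f n`. -/
def seqInv (n : ℕ) (f : ℕ → ℤ) : ℕ :=
  ((Icc 1 n ×ˢ Icc 1 n).filter fun p => p.1 < p.2 ∧ f p.2 < f p.1).card
  + ((Icc 1 n ×ˢ Icc 1 n).filter fun p => p.1 < p.2 ∧ f p.2 < -f p.1).card

/-- `odes_D` of a sequence `f 1, …, f n`. -/
def seqOdes (n : ℕ) (f : ℕ → ℤ) : ℕ :=
  ((Icc 1 (n - 1)).filter fun i => Odd i ∧ f (i + 1) < f i).card
  + (if f 2 < -f 1 then 1 else 0)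

/-- `edes_D` of a sequence `f 1, …, f n`. -/
def seqEdes (n : ℕ) (f : ℕ → ℤ) : ℕ :=
  ((Icc 1 (n - 1)).filter fun i => Even i ∧ f (i + 1) < f i).card

/-- Two sequences have the same signed relative order at positions `1, …, n`. -/
def SameOrder (n : ℕ) (f g : ℕ → ℤ) : Prop :=
  ∀ j k, 1 ≤ j → j ≤ n → 1 ≤ k → k ≤ n → j ≠ k →
    (f j < f k ↔ g j < g k) ∧ (f j < -f k ↔ g j < -g k)

theorem SameOrder.seqInv_eq {n : ℕ} {f g : ℕ → ℤ} (h : SameOrder n f g) :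
    seqInv n f = seqInv n g := by
  unfold seqInv
  congr 2 <;> apply filter_congr <;> rintro ⟨a, b⟩ hab <;>
    simp only [mem_product, mem_Icc] at hab <;> apply and_congr_right <;> intro hlt
  · exact (h b a (by omega) (by omega) (by omega) (by omega) (by simp at hlt; omega)).1
  · exact (h b a (by omega) (by omega) (by omega) (by omega) (by simp at hlt; omega)).2

theorem SameOrder.seqEdes_eq {n : ℕ} {f g : ℕ → ℤ} (h : SameOrder n f g) :
    seqEdes n f = seqEdes n g := by
  unfold seqEdes
  congr 1
  apply filter_congr
  intro a ha
  simp only [mem_Icc] at ha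
  rw [(h (a + 1) a (by omega) (by omega) (by omega) (by omega) (by omega)).1]

theorem SameOrder.seqOdes_eq {n : ℕ} (hn : 2 ≤ n) {f g : ℕ → ℤ} (h : SameOrder n f g) :
    seqOdes n f = seqOdes n g := by
  unfold seqOdes
  congr 2
  · apply filter_congr
    intro a ha
    simp only [mem_Icc] at ha
    rw [(h (a + 1) a (by omega) (by omega) (by omega) (by omega) (by omega)).1]
  · rw [(h 2 1 (by omega) (by omega) (by omega) (by omega) (by omega)).2]

theorem sameOrder_of_natAbs {n : ℕ} {f g : ℕ → ℤ}
    (hne : ∀ j k, 1 ≤ j → j ≤ n → 1 ≤ k → k ≤ n → j ≠ k → (f j).natAbs ≠ (f k).natAbs)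
    (hsign : ∀ j, 1 ≤ j → j ≤ n → (f j < 0 ↔ g j < 0) ∧ f j ≠ 0 ∧ g j ≠ 0)
    (habs : ∀ j k, 1 ≤ j → j ≤ n → 1 ≤ k → k ≤ n →
      ((f j).natAbs < (f k).natAbs ↔ (g j).natAbs < (g k).natAbs)) :
    SameOrder n f g := by
  intro j k hj hj' hk hk' hjk
  have h1 := habs j k hj hj' hk hk'
  have h2 := habs k j hk hk' hj hj'
  have h3 := hsign j hj hj'
  have h4 := hsign k hk hk'
  have h5 := hne j k hj hj' hk hk' hjk
  omega

/-- The contribution of a pair of entries to `inv_D`. -/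
def pairInv (x y : ℤ) : ℕ := (if y < x then 1 else 0) + (if y < -x then 1 else 0)

theorem sum_Icc_one_eq_sum_fin_s15 {A : Type*} [AddCommMonoid A] (n : ℕ) (g : ℕ → A) :
    ∑ j ∈ Icc 1 n, g j = ∑ a : Fin n, g (a + 1) := by
  rw [Fin.sum_univ_eq_sum_range (fun j => g (j + 1)) n, range_eq_Ico, sum_Ico_add']
  rfl

theorem seqInv_eq_sum (n : ℕ) (f : ℕ → ℤ) :
    seqInv n f = ∑ a : Fin n, ∑ b : Fin n, if a < b then pairInv (f (a + 1)) (f (b + 1)) else 0 := by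
  have key : ∀ P : ℕ → ℕ → Prop, ∀ [∀ a b, Decidable (P a b)],
      ((Icc 1 n ×ˢ Icc 1 n).filter fun p => p.1 < p.2 ∧ P p.1 p.2).card =
      ∑ a : Fin n, ∑ b : Fin n, if a < b then (if P (a + 1) (b + 1) then 1 else 0) else 0 := by
    intro P _
    rw [card_filter, sum_product, sum_Icc_one_eq_sum_fin_s15]
    refine sum_congr rfl fun a _ => ?_
    rw [sum_Icc_one_eq_sum_fin_s15]
    refine sum_congr rfl fun b _ => ?_
    simp only [ite_and, add_lt_add_iff_right, Fin.lt_def]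
  unfold seqInv
  rw [key (fun a b => f b < f a), key (fun a b => f b < -f a), ← sum_add_distrib]
  refine sum_congr rfl fun a _ => ?_
  rw [← sum_add_distrib]
  refine sum_congr rfl fun b _ => ?_
  by_cases h : a < b <;> simp [h, pairInv]

theorem seqInv_add (i k : ℕ) (f : ℕ → ℤ) :
    seqInv (i + k) f = seqInv i f
      + (∑ a : Fin i, ∑ b : Fin k, pairInv (f (a + 1)) (f (i + b + 1)))
      + ∑ a : Fin k, ∑ b : Fin k,
          if a < b then pairInv (f (i + a + 1)) (f (i + b + 1)) else 0 := by
  rw [seqInv_eq_sum, seqInv_eq_sum i]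
  simp only [Fin.sum_univ_add, Fin.val_castAdd, Fin.val_natAdd, Fin.lt_def]
  have h1 : ∀ (a : Fin i) (b : Fin k), (a : ℕ) < i + b := fun a b => by omega
  have h2 : ∀ (a : Fin k) (b : Fin i), ¬ (i + (a : ℕ) < b) := fun a b => by omega
  simp only [h1, h2, if_true, if_false, sum_const_zero, zero_add, add_lt_add_iff_left,
    sum_add_distrib]

/-- Sums of a symmetric function over pairs `a < b` are invariant under permutations. -/
theorem sum_lt_perm {k : ℕ} (e : Fin k → Fin k → ℕ) (he : ∀ a b, e a b = e b a)
    (v : Equiv.Perm (Fin k)) :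
    (∑ a, ∑ b, if a < b then e (v a) (v b) else 0) = ∑ a, ∑ b, if a < b then e a b else 0 := by
  have key : ∀ e : Fin k → Fin k → ℕ, (∀ a b, e a b = e b a) →
      ∑ a, ∑ b, e a b = 2 * (∑ a, ∑ b, if a < b then e a b else 0) + ∑ a, e a a := by
    intro e he
    have h1 : (∑ a, ∑ b, if a < b then e a b else 0) = ∑ a, ∑ b, if b < a then e a b else 0 := by
      rw [sum_comm]
      simp only [he]
    have h2 : ∑ a, e a a = ∑ a, ∑ b, if a = b then e a b else 0 := by simp
    rw [two_mul]
    nth_rw 2 [h1]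
    rw [h2, ← sum_add_distrib, ← sum_add_distrib]
    refine sum_congr rfl fun a _ => ?_
    rw [← sum_add_distrib, ← sum_add_distrib]
    refine sum_congr rfl fun b _ => ?_
    rcases lt_trichotomy a b with h | h | h
    · simp [h, h.ne, h.not_gt]
    · simp [h]
    · simp [h, h.ne', h.not_gt]
  have h1 := key e he
  have h2 := key (fun a b => e (v a) (v b)) fun a b => he _ _
  have h3 : ∑ a, ∑ b, e (v a) (v b) = ∑ a, ∑ b, e a b := by
    rw [← Equiv.sum_comp v (fun a => ∑ b, e a b)]
    exact sum_congr rfl fun a _ => Equiv.sum_comp v (e (v a))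
  have h4 : ∑ a, e (v a) (v a) = ∑ a, e a a := Equiv.sum_comp v fun a => e a a
  omega

end OrderStatistics

section PermutationInversions

/-- Number of inversions of a finite sequence. -/
def finInv {k : ℕ} {α : Type*} [LT α] [DecidableLT α] (y : Fin k → α) : ℕ :=
  ∑ a, ∑ b, if a < b then (if y b < y a then 1 else 0) else 0

theorem finInv_congr {k : ℕ} {α β : Type*} [LT α] [DecidableLT α] [LT β] [DecidableLT β]
    {y : Fin k → α} {z : Fin k → β} (h : ∀ a b, y a < y b ↔ z a < z b) : finInv y = finInv z := by
  simp only [finInv, h]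

theorem finInv_eq_zero_of_strictMono {k : ℕ} {α : Type*} [LinearOrder α] {y : Fin k → α}
    (hy : StrictMono y) : finInv y = 0 := by
  refine sum_eq_zero fun a _ => sum_eq_zero fun b _ => ?_
  split_ifs with h1 h2
  · exact absurd h2 (hy h1).not_gt
  · rfl
  · rfl

theorem exists_perm_sameOrder {k : ℕ} {α : Type*} [LinearOrder α] {y : Fin k → α}
    (hy : Function.Injective y) : ∃ τ : Equiv.Perm (Fin k), ∀ a b, y a < y b ↔ τ a < τ b := by
  refine ⟨(Tuple.sort y)⁻¹, fun a b => ?_⟩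
  have h : StrictMono (y ∘ Tuple.sort y) :=
    (Tuple.monotone_sort y).strictMono_of_injective (hy.comp (Tuple.sort y).injective)
  rw [← h.lt_iff_lt]
  simp

theorem card_succAbove_lt {n : ℕ} (p : Fin (n + 1)) :
    (∑ j : Fin n, if p.succAbove j < p then 1 else 0) = (p : ℕ) := by
  have h1 : (∑ j : Fin (n + 1), if j < p then 1 else 0) = (p : ℕ) := by
    rw [← card_filter, ← Fin.card_Iio p]
    congr 1
    ext j
    simp
  rw [Fin.sum_univ_succAbove _ p] at h1
  simpa using h1

/-- The permutation of `Fin (n + 1)` with first value `p` and remaining values ordered as `e`. -/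
def consPerm {n : ℕ} (x : Fin (n + 1) × Equiv.Perm (Fin n)) : Equiv.Perm (Fin (n + 1)) :=
  x.1.cycleRange.symm * Equiv.Perm.decomposeFin.symm (0, x.2)

theorem consPerm_zero {n : ℕ} (x : Fin (n + 1) × Equiv.Perm (Fin n)) :
    consPerm x 0 = x.1 := by
  simp [consPerm]

theorem consPerm_succ {n : ℕ} (x : Fin (n + 1) × Equiv.Perm (Fin n)) (j : Fin n) :
    consPerm x j.succ = x.1.succAbove (x.2 j) := by
  simp [consPerm]

theorem consPerm_bijective {n : ℕ} : Function.Bijective (consPerm (n := n)) := by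
  rw [Fintype.bijective_iff_injective_and_card]
  refine ⟨fun x y h => ?_, by simp [Fintype.card_perm, Nat.factorial_succ]⟩
  have h0 : x.1 = y.1 := by rw [← consPerm_zero, h, consPerm_zero]
  refine Prod.ext h0 (Equiv.ext fun j => ?_)
  have h1 := consPerm_succ x j
  rw [h, consPerm_succ, ← h0] at h1
  exact (Fin.succAbove_right_injective h1).symm

theorem finInv_consPerm {n : ℕ} (x : Fin (n + 1) × Equiv.Perm (Fin n)) :
    finInv (consPerm x) = x.1 + finInv x.2 := by
  unfold finInv
  simp only [Fin.sum_univ_succ, consPerm_zero, consPerm_succ, Fin.succ_lt_succ_iff,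
    Fin.succ_pos, if_true, if_false, Fin.not_lt_zero, zero_add]
  congr 1
  · rw [← card_succAbove_lt x.1]
    exact Equiv.sum_comp x.2 fun j => if x.1.succAbove j < x.1 then 1 else 0
  · simp only [(Fin.strictMono_succAbove x.1).lt_iff_lt]

theorem sum_perm_finInv {A : Type*} [CommRing A] (k : ℕ) (q : A) :
    ∑ v : Equiv.Perm (Fin k), q ^ finInv v = qFact k q := by
  induction k with
  | zero => simp [finInv, qFact]
  | succ k ih =>
    rw [qFact, prod_range_succ, ← qFact, ← ih,
      ← Function.Bijective.sum_comp consPerm_bijective fun v => q ^ finInv v, Fintype.sum_prod_type]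
    simp only [finInv_consPerm, pow_add, ← mul_sum, ← sum_mul]
    rw [mul_comm, qInt, Fin.sum_univ_eq_sum_range (fun j => q ^ j)]

end PermutationInversions

section SignedPermutations

theorem bval_succ_s15 {n : ℕ} (w : BG n) (a : Fin n) :
    bval w (a + 1) = (if w.2 a then -1 else 1) * (((w.1 a : Fin n) : ℕ) + 1 : ℤ) := by
  have h : 1 ≤ (a : ℕ) + 1 ∧ (a : ℕ) + 1 ≤ n := by omega
  simp [bval, h]

theorem natAbs_bval {n : ℕ} (w : BG n) (a : Fin n) : (bval w (a + 1)).natAbs = w.1 a + 1 := by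
  rw [bval_succ_s15]
  split_ifs <;> omega

theorem bval_neg_iff {n : ℕ} (w : BG n) (a : Fin n) : bval w (a + 1) < 0 ↔ w.2 a = true := by
  rw [bval_succ_s15]
  split_ifs with h <;> simp only [h] <;> simp <;> omega

theorem exists_fin_succ {n j : ℕ} (h1 : 1 ≤ j) (h2 : j ≤ n) : ∃ a : Fin n, j = a + 1 :=
  ⟨⟨j - 1, by omega⟩, by simp; omega⟩

theorem natAbs_bval_ne {n : ℕ} (w : BG n) {j k : ℕ} (hj : 1 ≤ j) (hj' : j ≤ n) (hk : 1 ≤ k)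
    (hk' : k ≤ n) (hjk : j ≠ k) : (bval w j).natAbs ≠ (bval w k).natAbs := by
  obtain ⟨a, rfl⟩ := exists_fin_succ hj hj'
  obtain ⟨b, rfl⟩ := exists_fin_succ hk hk'
  rw [natAbs_bval, natAbs_bval]
  intro h
  have h' : w.1 a = w.1 b := Fin.ext (by omega)
  exact hjk (by rw [w.1.injective h'])

theorem eq_of_bval_eq {n : ℕ} {w w' : BG n} (h : ∀ a : Fin n, bval w (a + 1) = bval w' (a + 1)) :
    w = w' := by
  refine Prod.ext (Equiv.ext fun a => Fin.ext ?_) (funext fun a => ?_)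
  · have h1 := natAbs_bval w a
    have h2 := natAbs_bval w' a
    rw [h a] at h1
    omega
  · rw [Bool.eq_iff_iff, ← bval_neg_iff, ← bval_neg_iff, h a]

/-- Composition of signed permutations. -/
def signedMul {i : ℕ} (p u : BG i) : BG i :=
  (p.1 * u.1, fun a => xor (p.2 (u.1 a)) (u.2 a))

theorem signedMul_bijective {i : ℕ} (p : BG i) : Function.Bijective (signedMul p) := by
  rw [← Finite.injective_iff_bijective]
  intro u u' h
  have h1 : u.1 = u'.1 := mul_left_cancel (congrArg Prod.fst h)
  refine Prod.ext h1 (funext fun a => ?_)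
  have h2 := congrFun (congrArg Prod.snd h) a
  simp only [signedMul, h1] at h2
  simpa using h2

/-- Right action of `𝔅_i` on the first `i` entries of an element of `𝔅_{i+k}`. -/
def prefixMul {i k : ℕ} (u : BG i) (w : BG (i + k)) : BG (i + k) :=
  (w.1 * finSumFinEquiv.permCongr (Equiv.Perm.sumCongr u.1 1),
    Fin.addCases (fun a => xor (w.2 (Fin.castAdd k (u.1 a))) (u.2 a)) fun b => w.2 (Fin.natAdd i b))

/-- Right action of permutations on the last `k` entries of an element of `𝔅_{i+k}`. -/
def suffixMul {i k : ℕ} (v : Equiv.Perm (Fin k)) (w : BG (i + k)) : BG (i + k) :=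
  (w.1 * finSumFinEquiv.permCongr (Equiv.Perm.sumCongr 1 v),
    Fin.addCases (fun a => w.2 (Fin.castAdd k a)) fun b => w.2 (Fin.natAdd i (v b)))

variable {i k : ℕ}

theorem prefixMul_fst_castAdd (u : BG i) (w : BG (i + k)) (a : Fin i) :
    (prefixMul u w).1 (Fin.castAdd k a) = w.1 (Fin.castAdd k (u.1 a)) := by
  simp [prefixMul, Equiv.permCongr_apply]

theorem prefixMul_snd_castAdd (u : BG i) (w : BG (i + k)) (a : Fin i) :
    (prefixMul u w).2 (Fin.castAdd k a) = xor (w.2 (Fin.castAdd k (u.1 a))) (u.2 a) := by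
  simp [prefixMul]

theorem bval_prefixMul_castAdd (u : BG i) (w : BG (i + k)) (a : Fin i) :
    bval (prefixMul u w) (a + 1) = (if u.2 a then -1 else 1) * bval w (u.1 a + 1) := by
  have h1 := bval_succ_s15 (prefixMul u w) (Fin.castAdd k a)
  have h2 := bval_succ_s15 w (Fin.castAdd k (u.1 a))
  rw [prefixMul_fst_castAdd, prefixMul_snd_castAdd] at h1
  simp only [Fin.val_castAdd] at h1 h2
  rw [h1, h2]
  cases w.2 (Fin.castAdd k (u.1 a)) <;> cases u.2 a <;> simp

theorem bval_prefixMul_natAdd (u : BG i) (w : BG (i + k)) (b : Fin k) :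
    bval (prefixMul u w) (i + b + 1) = bval w (i + b + 1) := by
  have h1 := bval_succ_s15 (prefixMul u w) (Fin.natAdd i b)
  have h2 := bval_succ_s15 w (Fin.natAdd i b)
  simp only [Fin.val_natAdd] at h1 h2
  rw [h1, h2]
  simp [prefixMul, Equiv.permCongr_apply]

theorem bval_suffixMul_castAdd (v : Equiv.Perm (Fin k)) (w : BG (i + k)) (a : Fin i) :
    bval (suffixMul v w) (a + 1) = bval w (a + 1) := by
  have h1 := bval_succ_s15 (suffixMul v w) (Fin.castAdd k a)
  have h2 := bval_succ_s15 w (Fin.castAdd k a)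
  simp only [Fin.val_castAdd] at h1 h2
  rw [h1, h2]
  simp [suffixMul, Equiv.permCongr_apply]

theorem bval_suffixMul_natAdd (v : Equiv.Perm (Fin k)) (w : BG (i + k)) (b : Fin k) :
    bval (suffixMul v w) (i + b + 1) = bval w (i + v b + 1) := by
  have h1 := bval_succ_s15 (suffixMul v w) (Fin.natAdd i b)
  have h2 := bval_succ_s15 w (Fin.natAdd i (v b))
  simp only [Fin.val_natAdd] at h1 h2
  rw [h1, h2]
  simp [suffixMul, Equiv.permCongr_apply]

theorem prefixMul_injective (u : BG i) : Function.Injective (prefixMul (k := k) u) := by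
  intro w w' h
  refine eq_of_bval_eq fun x => ?_
  refine Fin.addCases (fun a => ?_) (fun b => ?_) x
  · have h1 := bval_prefixMul_castAdd u w (u.1.symm a)
    rw [h, bval_prefixMul_castAdd, Equiv.apply_symm_apply] at h1
    simp only [Fin.val_castAdd]
    split_ifs at h1 <;> omega
  · simp only [Fin.val_natAdd]
    rw [← bval_prefixMul_natAdd u, h, bval_prefixMul_natAdd]

theorem suffixMul_injective (v : Equiv.Perm (Fin k)) :
    Function.Injective (suffixMul (i := i) v) := by
  intro w w' h
  refine eq_of_bval_eq fun x => ?_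
  refine Fin.addCases (fun a => ?_) (fun b => ?_) x
  · simp only [Fin.val_castAdd]
    rw [← bval_suffixMul_castAdd v, h, bval_suffixMul_castAdd]
  · have h1 := bval_suffixMul_natAdd v w (v.symm b)
    rw [h, bval_suffixMul_natAdd, Equiv.apply_symm_apply] at h1
    simpa using h1.symm

theorem sum_prefixMul {A : Type*} [CommRing A] (φ : (ℕ → ℤ) → A)
    (hφ : ∀ f g, SameOrder i f g → φ f = φ g) (w : BG (i + k)) :
    ∑ u : BG i, φ (bval (prefixMul u w)) = ∑ u : BG i, φ (bval u) := by
  obtain ⟨τ, hτ⟩ := exists_perm_sameOrder (y := fun a : Fin i => w.1 (Fin.castAdd k a))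
    (w.1.injective.comp (Fin.castAdd_injective i k))
  set p : BG i := (τ, fun a => w.2 (Fin.castAdd k a))
  rw [← (signedMul_bijective p).sum_comp fun u => φ (bval u)]
  refine sum_congr rfl fun u _ => hφ _ _ ?_
  have hl : ∀ a : Fin i, (bval (prefixMul u w) (a + 1)).natAbs = w.1 (Fin.castAdd k (u.1 a)) + 1 :=
    fun a => by
      rw [← prefixMul_fst_castAdd, ← natAbs_bval]
      rfl
  have hr : ∀ a : Fin i, (bval (signedMul p u) (a + 1)).natAbs = τ (u.1 a) + 1 :=
    fun a => natAbs_bval _ a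
  have hs : ∀ a : Fin i, bval (prefixMul u w) (a + 1) < 0 ↔ bval (signedMul p u) (a + 1) < 0 :=
    fun a => by
      rw [bval_neg_iff]
      refine (bval_neg_iff (prefixMul u w) (Fin.castAdd k a)).trans ?_
      rw [prefixMul_snd_castAdd]
      rfl
  refine sameOrder_of_natAbs ?_ ?_ ?_
  · exact fun j l hj hj' hl hl' hjl =>
      natAbs_bval_ne (prefixMul u w) hj (by omega) hl (by omega) hjl
  · intro j hj hj'
    obtain ⟨a, rfl⟩ := exists_fin_succ hj hj'
    have h1 := hl a
    have h2 := hr a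
    exact ⟨hs a, by omega, by omega⟩
  · intro j l hj hj' hl0 hl'
    obtain ⟨a, rfl⟩ := exists_fin_succ hj hj'
    obtain ⟨b, rfl⟩ := exists_fin_succ hl0 hl'
    have h := hτ (u.1 a) (u.1 b)
    rw [hl, hl, hr, hr]
    simpa only [add_lt_add_iff_right, ← Fin.lt_def] using h

end SignedPermutations

section Averaging

theorem card_mul_sum_eq {α β A : Type*} [Fintype α] [Fintype β] [CommRing A] (act : β → α → α)
    (hact : ∀ u, Function.Injective (act u)) (c φ : α → A) (hc : ∀ u w, c (act u w) = c w) (C : A)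
    (hφ : ∀ w, ∑ u, φ (act u w) = C) :
    (Fintype.card β : A) * ∑ w, c w * φ w = C * ∑ w, c w := by
  have h1 : ∀ u, ∑ w, c w * φ w = ∑ w, c w * φ (act u w) := fun u => by
    rw [← (Finite.injective_iff_bijective.1 (hact u)).sum_comp fun w => c w * φ w]
    simp only [hc]
  calc (Fintype.card β : A) * ∑ w, c w * φ w = ∑ _u : β, ∑ w, c w * φ w := by simp
    _ = ∑ u, ∑ w, c w * φ (act u w) := sum_congr rfl fun u _ => h1 u
    _ = ∑ w, c w * ∑ u, φ (act u w) := by rw [sum_comm]; simp only [mul_sum]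
    _ = ∑ w, C * c w := sum_congr rfl fun w _ => by rw [hφ, mul_comm]
    _ = C * ∑ w, c w := by rw [mul_sum]

theorem sum_mul_sum_eq {α β A : Type*} [Fintype α] [Fintype β] [Nonempty β] [Field A] [CharZero A]
    (act : β → α → α) (hact : ∀ u, Function.Injective (act u)) (c φ ψ : α → A)
    (hc : ∀ u w, c (act u w) = c w) (C D : A) (hφ : ∀ w, ∑ u, φ (act u w) = C)
    (hψ : ∀ w, ∑ u, ψ (act u w) = D) :
    D * ∑ w, c w * φ w = C * ∑ w, c w * ψ w := by
  have h1 := card_mul_sum_eq act hact c φ hc C hφ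
  have h2 := card_mul_sum_eq act hact c ψ hc D hψ
  have h3 : (Fintype.card β : A) ≠ 0 := by simp
  apply mul_left_cancel₀ h3
  linear_combination D * h1 - C * h2

end Averaging

section RunSums

variable {i k : ℕ} {A : Type*} [Field A] [CharZero A]

/-- The entries `f (i + 1), …, f n` increase. -/
def IncreasesAfter (n i : ℕ) (f : ℕ → ℤ) : Prop :=
  ∀ j : ℕ, j < n → i + 1 ≤ j → f j < f (j + 1)

theorem increasesAfter_iff_strictMono (f : ℕ → ℤ) :
    IncreasesAfter (i + k) i f ↔ StrictMono fun b : Fin k => f (i + b + 1) := by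
  cases k with
  | zero => exact ⟨fun _ a => a.elim0, fun _ j hj hj' => by omega⟩
  | succ k =>
    rw [Fin.strictMono_iff_lt_succ]
    constructor
    · intro h b
      have := h (i + b + 1) (by omega) (by omega)
      simpa [add_assoc] using this
    · intro h j hj hj'
      have := h ⟨j - i - 1, by omega⟩
      simp only [Fin.val_castSucc, Fin.val_succ] at this
      rwa [show i + (j - i - 1) + 1 = j by omega, show i + (j - i - 1 + 1) + 1 = j + 1 by omega]
        at this

theorem pairInv_neg_left (x y : ℤ) : pairInv (-x) y = pairInv x y := by
  simp [pairInv, add_comm]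

/-- The inversions of `f 1, …, f (i + k)` between the first `i` and the last `k` entries. -/
def crossInv (i k : ℕ) (f : ℕ → ℤ) : ℕ :=
  ∑ a : Fin i, ∑ b : Fin k, pairInv (f (a + 1)) (f (i + b + 1))

/-- The inversions of `f 1, …, f (i + k)` among the last `k` entries. -/
def tailInv (i k : ℕ) (f : ℕ → ℤ) : ℕ :=
  ∑ a : Fin k, ∑ b : Fin k, if a < b then pairInv (f (i + a + 1)) (f (i + b + 1)) else 0

/-- The pairs among the last `k` entries of `f 1, …, f (i + k)` with negative sum. -/
def tailNegPairs (i k : ℕ) (f : ℕ → ℤ) : ℕ :=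
  ∑ a : Fin k, ∑ b : Fin k, if a < b then (if f (i + b + 1) < -f (i + a + 1) then 1 else 0) else 0

theorem tailInv_eq (f : ℕ → ℤ) :
    tailInv i k f = finInv (fun b : Fin k => f (i + b + 1)) + tailNegPairs i k f := by
  unfold tailInv finInv tailNegPairs
  simp only [← sum_add_distrib]
  refine sum_congr rfl fun a _ => sum_congr rfl fun b _ => ?_
  split_ifs <;> simp_all [pairInv]

theorem invD_eq (w : BG (i + k)) :
    invD w = seqInv i (bval w) + (crossInv i k (bval w) + tailInv i k (bval w)) := by
  rw [← add_assoc]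
  exact seqInv_add i k (bval w)

theorem crossInv_prefixMul (u : BG i) (w : BG (i + k)) :
    crossInv i k (bval (prefixMul u w)) = crossInv i k (bval w) := by
  unfold crossInv
  simp only [bval_prefixMul_castAdd, bval_prefixMul_natAdd]
  rw [← Equiv.sum_comp u.1 fun a => ∑ b : Fin k, pairInv (bval w (a + 1)) (bval w (i + b + 1))]
  refine sum_congr rfl fun a _ => sum_congr rfl fun b _ => ?_
  split_ifs
  · rw [neg_one_mul, pairInv_neg_left]
  · rw [one_mul]

theorem crossInv_suffixMul (v : Equiv.Perm (Fin k)) (w : BG (i + k)) :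
    crossInv i k (bval (suffixMul v w)) = crossInv i k (bval w) := by
  unfold crossInv
  simp only [bval_suffixMul_castAdd, bval_suffixMul_natAdd]
  exact sum_congr rfl fun a _ =>
    Equiv.sum_comp v fun b => pairInv (bval w (a + 1)) (bval w (i + b + 1))

theorem tailNegPairs_suffixMul (v : Equiv.Perm (Fin k)) (w : BG (i + k)) :
    tailNegPairs i k (bval (suffixMul v w)) = tailNegPairs i k (bval w) := by
  unfold tailNegPairs
  simp only [bval_suffixMul_natAdd]
  refine sum_lt_perm (fun a b => if bval w (i + b + 1) < -bval w (i + a + 1) then 1 else 0)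
    (fun a b => ?_) v
  congr 1
  exact propext ⟨fun h => by omega, fun h => by omega⟩

theorem seqInv_suffixMul (v : Equiv.Perm (Fin k)) (w : BG (i + k)) :
    seqInv i (bval (suffixMul v w)) = seqInv i (bval w) := by
  simp only [seqInv_eq_sum, bval_suffixMul_castAdd]

open Classical in
theorem prefix_sum_identity (hi : 2 ≤ i) (s t q : A) :
    (∑ u : BG i, q ^ invD u) *
      (∑ w : BG (i + k), if IncreasesAfter (i + k) i (bval w) then
        s ^ seqEdes i (bval w) * t ^ seqOdes i (bval w) * q ^ invD w else 0) =
    (∑ u : BG i, s ^ edesD u * t ^ odesD u * q ^ invD u) *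
      ∑ w : BG (i + k), if IncreasesAfter (i + k) i (bval w) then q ^ invD w else 0 := by
  have h := sum_mul_sum_eq (prefixMul (i := i) (k := k)) prefixMul_injective
    (fun w => if IncreasesAfter (i + k) i (bval w) then
      q ^ (crossInv i k (bval w) + tailInv i k (bval w)) else 0)
    (fun w => s ^ seqEdes i (bval w) * t ^ seqOdes i (bval w) * q ^ seqInv i (bval w))
    (fun w => q ^ seqInv i (bval w)) ?_
    (∑ u : BG i, s ^ edesD u * t ^ odesD u * q ^ invD u) (∑ u : BG i, q ^ invD u)
    (sum_prefixMul (fun f => s ^ seqEdes i f * t ^ seqOdes i f * q ^ seqInv i f)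
      fun f g hfg => by rw [hfg.seqEdes_eq, hfg.seqOdes_eq hi, hfg.seqInv_eq])
    (sum_prefixMul (fun f => q ^ seqInv i f) fun f g hfg => by rw [hfg.seqInv_eq])
  · convert h using 2 <;> refine sum_congr rfl fun w _ => ?_ <;> split_ifs <;>
      simp only [invD_eq, zero_mul] <;> ring
  · intro u w
    rw [crossInv_prefixMul]
    simp only [increasesAfter_iff_strictMono, tailInv, bval_prefixMul_natAdd]

theorem bval_suffix_injective (w : BG (i + k)) :
    Function.Injective fun b : Fin k => bval w (i + b + 1) := by
  intro a b hab
  by_contra hne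
  have h : (a : ℕ) ≠ b := fun h => hne (Fin.ext h)
  exact natAbs_bval_ne w (j := i + a + 1) (k := i + b + 1) (by omega) (by omega) (by omega)
    (by omega) (by omega) (congrArg Int.natAbs hab)

theorem strictMono_perm_iff (v : Equiv.Perm (Fin k)) : StrictMono v ↔ v = 1 := by
  constructor
  · intro h
    let e : Fin k ≃o Fin k := h.orderIsoOfSurjective v v.surjective
    ext a
    have : e a = OrderIso.refl _ a := by rw [Subsingleton.elim e (OrderIso.refl _)]
    exact congrArg Fin.val this
  · rintro rfl
    exact strictMono_id

open Classical in
theorem sum_invD_eq_qFact_mul (q : A) :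
    ∑ w : BG (i + k), q ^ invD w =
      qFact k q *
        ∑ w : BG (i + k), if IncreasesAfter (i + k) i (bval w) then q ^ invD w else 0 := by
  have h := sum_mul_sum_eq (suffixMul (i := i) (k := k)) suffixMul_injective
    (fun w => q ^ (seqInv i (bval w) + crossInv i k (bval w) + tailNegPairs i k (bval w)))
    (fun w => q ^ finInv fun b : Fin k => bval w (i + b + 1))
    (fun w => if StrictMono fun b : Fin k => bval w (i + b + 1) then 1 else 0) ?_
    (qFact k q) 1 ?_ ?_
  · rw [one_mul] at h
    convert h using 2
    · rw [invD_eq, tailInv_eq]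
      ring
    · refine sum_congr rfl fun w _ => ?_
      rw [increasesAfter_iff_strictMono]
      split_ifs with hw
      · rw [invD_eq, tailInv_eq, finInv_eq_zero_of_strictMono hw]
        ring
      · ring
  · intro v w
    rw [crossInv_suffixMul, tailNegPairs_suffixMul, seqInv_suffixMul]
  · intro w
    obtain ⟨τ, hτ⟩ := exists_perm_sameOrder (bval_suffix_injective w)
    rw [← sum_perm_finInv, ← Equiv.sum_comp (Equiv.mulLeft τ) fun v => q ^ finInv v]
    refine sum_congr rfl fun v _ => ?_
    congr 1
    refine finInv_congr fun a b => ?_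
    simp only [bval_suffixMul_natAdd]
    exact hτ _ _
  · intro w
    obtain ⟨τ, hτ⟩ := exists_perm_sameOrder (bval_suffix_injective w)
    have key : ∀ v, (StrictMono fun b : Fin k => bval (suffixMul v w) (i + b + 1)) ↔ v = τ⁻¹ := by
      intro v
      rw [eq_inv_iff_mul_eq_one, mul_eq_one_iff_eq_inv, eq_comm, inv_eq_iff_mul_eq_one,
        ← strictMono_perm_iff]
      simp only [StrictMono, bval_suffixMul_natAdd]
      exact forall₃_congr fun a b _ => hτ _ _
    simp only [key, sum_ite_eq', mem_univ, if_true]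

end RunSums

section SignFlip

variable {n : ℕ}

/-- Change the sign of the entry of absolute value `1`. -/
def flipOne (hn : 0 < n) (w : BG n) : BG n :=
  (w.1, Function.update w.2 (w.1.symm ⟨0, hn⟩) !(w.2 (w.1.symm ⟨0, hn⟩)))

theorem flipOne_flipOne (hn : 0 < n) (w : BG n) : flipOne hn (flipOne hn w) = w := by
  simp [flipOne]

theorem bval_flipOne (hn : 0 < n) (w : BG n) {j : ℕ} (hj : 1 ≤ j) (hj' : j ≤ n) :
    bval (flipOne hn w) j = if (bval w j).natAbs = 1 then -bval w j else bval w j := by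
  obtain ⟨a, rfl⟩ := exists_fin_succ hj hj'
  rw [natAbs_bval]
  by_cases h : w.1 a = ⟨0, hn⟩
  · have ha : a = w.1.symm ⟨0, hn⟩ := by rw [← h, Equiv.symm_apply_apply]
    rw [if_pos (by rw [h]), bval_succ_s15, bval_succ_s15]
    have h1 : (flipOne hn w).1 = w.1 := rfl
    have h2 : (flipOne hn w).2 a = !(w.2 a) := by simp [flipOne, ← ha]
    rw [h1, h2]
    cases w.2 a <;> simp
  · have ha : a ≠ w.1.symm ⟨0, hn⟩ := fun ha => h (by rw [ha, Equiv.apply_symm_apply])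
    have h0 : ¬ ((w.1 a : ℕ) + 1 = 1) := fun h0 => h (Fin.ext (by simpa using h0))
    rw [if_neg h0, bval_succ_s15, bval_succ_s15]
    have h1 : (flipOne hn w).1 = w.1 := rfl
    have h2 : (flipOne hn w).2 a = w.2 a := by simp [flipOne, Function.update_of_ne ha]
    rw [h1, h2]

theorem sameOrder_flipOne (hn : 0 < n) (w : BG n) :
    SameOrder n (bval (flipOne hn w)) (bval w) := by
  intro j k hj hj' hk hk' hjk
  have h := natAbs_bval_ne w hj hj' hk hk' hjk
  have h0 : ∀ l, 1 ≤ l → l ≤ n → bval w l ≠ 0 := fun l hl hl' => by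
    obtain ⟨a, rfl⟩ := exists_fin_succ hl hl'
    have := natAbs_bval w a
    omega
  have h1 := h0 j hj hj'
  have h2 := h0 k hk hk'
  rw [bval_flipOne hn w hj hj', bval_flipOne hn w hk hk']
  split_ifs <;> omega

theorem negs_eq_sum (w : BG n) : negs w = ∑ a : Fin n, if w.2 a then 1 else 0 := by
  unfold negs
  rw [card_filter, sum_Icc_one_eq_sum_fin_s15]
  simp only [bval_neg_iff]

theorem even_negs_flipOne (hn : 0 < n) (w : BG n) : Even (negs (flipOne hn w)) ↔ ¬ Even (negs w) := by
  have h : negs (flipOne hn w) + negs w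
      + 2 * (if w.2 (w.1.symm ⟨0, hn⟩) then 1 else 0) = 2 * negs w + 1 := by
    set c := w.1.symm ⟨0, hn⟩ with hc
    have h1 : (if w.2 c then 1 else 0) = ∑ a, if a = c then (if w.2 a then 1 else 0) else 0 := by
      simp
    have h2 : 1 = ∑ a : Fin n, if a = c then 1 else 0 := by simp
    rw [h1]
    conv_rhs => rw [h2]
    rw [negs_eq_sum, negs_eq_sum, mul_sum, mul_sum, ← sum_add_distrib, ← sum_add_distrib,
      ← sum_add_distrib]
    refine sum_congr rfl fun a _ => ?_
    by_cases ha : a = c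
    · have : (flipOne hn w).2 a = !(w.2 a) := by simp [flipOne, ha, ← hc]
      rw [this]
      cases w.2 a <;> simp [ha]
    · have : (flipOne hn w).2 a = w.2 a := by simp [flipOne, ← hc, Function.update_of_ne ha]
      rw [this]
      cases w.2 a <;> simp [ha]
  rw [Nat.even_iff, Nat.even_iff]
  omega

theorem two_mul_sum_DG {A : Type*} [CommRing A] (hn : 0 < n) (F : BG n → A)
    (hF : ∀ w, F (flipOne hn w) = F w) : 2 * ∑ w ∈ DG n, F w = ∑ w, F w := by
  rw [← sum_filter_add_sum_filter_not univ (fun w : BG n => Even (negs w)) F, two_mul]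
  congr 1
  refine sum_nbij' (flipOne hn) (flipOne hn) ?_ ?_ (fun w _ => flipOne_flipOne hn w)
    (fun w _ => flipOne_flipOne hn w) fun w _ => (hF w).symm
  · intro w hw
    simp only [DG, mem_filter, mem_univ, true_and] at hw ⊢
    rwa [even_negs_flipOne, not_not]
  · intro w hw
    simp only [DG, mem_filter, mem_univ, true_and] at hw ⊢
    rwa [even_negs_flipOne]

theorem two_mul_DOne {A : Type*} [CommRing A] (hn : 0 < n) (q : A) :
    2 * DOne n q = ∑ w : BG n, q ^ invD w :=
  two_mul_sum_DG hn _ fun w => congrArg (q ^ ·) (sameOrder_flipOne hn w).seqInv_eq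

theorem two_mul_Dpoly {A : Type*} [CommRing A] (hn : 2 ≤ n) (s t q : A) :
    2 * Dpoly n s t q = ∑ w : BG n, s ^ edesD w * t ^ odesD w * q ^ invD w :=
  two_mul_sum_DG (by omega) _ fun w => by
    have h := sameOrder_flipOne (by omega) w
    exact congrArg₂ _ (congrArg₂ _ (congrArg _ h.seqEdes_eq) (congrArg _ (h.seqOdes_eq hn)))
      (congrArg _ h.seqInv_eq)

theorem increasesAfter_flipOne (hn : 0 < n) (i : ℕ) (w : BG n) :
    IncreasesAfter n i (bval (flipOne hn w)) ↔ IncreasesAfter n i (bval w) :=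
  forall₃_congr fun j hj hj' =>
    (sameOrder_flipOne hn w j (j + 1) (by omega) (by omega) (by omega) (by omega) (by omega)).1

open Classical in
theorem two_mul_W_Hset (hn : 2 ≤ n) (i : ℕ) :
    2 * W (Hset n i) = ∑ w : BG n, if IncreasesAfter n i (bval w) then
      tK ^ odesD w * sK ^ edesD w * qK ^ invD w else 0 := by
  rw [← two_mul_sum_DG (by omega : 0 < n), W, Hset, sum_filter]
  · exact congrArg _ (sum_congr rfl fun w _ => if_congr Iff.rfl rfl rfl)
  · intro w
    have h := sameOrder_flipOne (by omega) w
    simp only [increasesAfter_flipOne]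
    have h1 : odesD (flipOne (by omega) w) = odesD w := h.seqOdes_eq hn
    have h2 : edesD (flipOne (by omega) w) = edesD w := h.seqEdes_eq
    have h3 : invD (flipOne (by omega) w) = invD w := h.seqInv_eq
    rw [h1, h2, h3]

end SignFlip

section Recursion

theorem card_filter_descents {n i : ℕ} (hi : 1 ≤ i) (hin : i ≤ n - 1) {f : ℕ → ℤ}
    (hf : IncreasesAfter n i f) (P : ℕ → Prop) [DecidablePred P] :
    ((Icc 1 (n - 1)).filter fun j => P j ∧ f (j + 1) < f j).card =
      ((Icc 1 (i - 1)).filter fun j => P j ∧ f (j + 1) < f j).card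
        + if P i ∧ f (i + 1) < f i then 1 else 0 := by
  have h : ((Icc 1 (n - 1)).filter fun j => P j ∧ f (j + 1) < f j) =
      (Icc 1 i).filter fun j => P j ∧ f (j + 1) < f j := by
    ext j
    simp only [mem_filter, mem_Icc]
    constructor
    · rintro ⟨hj, hP, hlt⟩
      refine ⟨⟨hj.1, ?_⟩, hP, hlt⟩
      by_contra hij
      exact lt_asymm hlt (hf j (by omega) (by omega))
    · rintro ⟨hj, h⟩
      exact ⟨⟨hj.1, by omega⟩, h⟩
  obtain ⟨m, rfl⟩ : ∃ m, i = m + 1 := ⟨i - 1, by omega⟩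
  rw [h, card_filter, card_filter, sum_Icc_succ_top (by omega)]
  rfl

theorem seqOdes_of_increasesAfter {n i : ℕ} (hi : 1 ≤ i) (hin : i ≤ n - 1) {f : ℕ → ℤ}
    (hf : IncreasesAfter n i f) :
    seqOdes n f = seqOdes i f + if Odd i ∧ f (i + 1) < f i then 1 else 0 := by
  rw [seqOdes, seqOdes, card_filter_descents hi hin hf]
  ring

theorem seqEdes_of_increasesAfter {n i : ℕ} (hi : 1 ≤ i) (hin : i ≤ n - 1) {f : ℕ → ℤ}
    (hf : IncreasesAfter n i f) :
    seqEdes n f = seqEdes i f + if Even i ∧ f (i + 1) < f i then 1 else 0 :=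
  card_filter_descents hi hin hf _

theorem increasesAfter_pred_iff {n i : ℕ} (hi : 1 ≤ i) (hin : i ≤ n - 1) (f : ℕ → ℤ) :
    IncreasesAfter n (i - 1) f ↔ IncreasesAfter n i f ∧ f i < f (i + 1) := by
  constructor
  · exact fun h => ⟨fun j hj hj' => h j hj (by omega), h i (by omega) (by omega)⟩
  · rintro ⟨h, h'⟩ j hj hj'
    rcases eq_or_ne j i with rfl | hne
    · exact h'
    · exact h j hj (by omega)

open Classical in
/-- Splitting `H_{n,i}` according to whether there is a descent at `i`. -/
theorem two_mul_W_Hset_eq {n i : ℕ} (hi : 1 ≤ i) (hin : i ≤ n - 1) (hn : 2 ≤ n) (x : K)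
    (hx : x = if Odd i then tK else sK) :
    2 * W (Hset n i) =
      x * (∑ w : BG n, if IncreasesAfter n i (bval w) then
        sK ^ seqEdes i (bval w) * tK ^ seqOdes i (bval w) * qK ^ invD w else 0)
      + (1 - x) * (2 * W (Hset n (i - 1))) := by
  rw [two_mul_W_Hset hn, two_mul_W_Hset hn, mul_sum, mul_sum, ← sum_add_distrib]
  refine sum_congr rfl fun w _ => ?_
  rw [increasesAfter_pred_iff hi hin]
  by_cases hw : IncreasesAfter n i (bval w)
  · have ho : odesD w = _ := seqOdes_of_increasesAfter hi hin hw
    have he : edesD w = _ := seqEdes_of_increasesAfter hi hin hw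
    rw [ho, he]
    have hne : bval w i ≠ bval w (i + 1) := fun h =>
      natAbs_bval_ne w hi (by omega) (by omega : 1 ≤ i + 1) (by omega) (by omega)
        (congrArg Int.natAbs h)
    rcases lt_or_gt_of_ne hne with hlt | hlt
    · simp only [hw, hlt, hlt.not_gt, and_self, and_false, if_true, if_false, add_zero]
      ring
    · by_cases hodd : Odd i
      · have heven : ¬ Even i := Nat.not_even_iff_odd.2 hodd
        simp only [hw, hlt, hlt.not_gt, hodd, heven, hx, and_true, and_false, if_true, if_false,
          add_zero]
        ring
      · have heven : Even i := Nat.not_odd_iff_even.1 hodd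
        simp only [hw, hlt, hlt.not_gt, hodd, heven, hx, and_true, and_false, if_true, if_false,
          add_zero]
        ring
  · simp [hw]

theorem run_recursion {n i : ℕ} (hi : 2 ≤ i) (hin : i ≤ n - 1) (hn : 2 ≤ n) (x : K)
    (hx : x = if Odd i then tK else sK) :
    DOne i qK * qFact (n - i) qK * W (Hset n i) =
      x * Dpoly i sK tK qK * DOne n qK
        + (1 - x) * (DOne i qK * qFact (n - i) qK * W (Hset n (i - 1))) := by
  have hW := two_mul_W_Hset_eq (by omega) hin hn x hx
  obtain ⟨k, rfl⟩ : ∃ k, n = i + k := ⟨n - i, by omega⟩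
  have h1 := prefix_sum_identity (k := k) hi sK tK qK
  have h2 := sum_invD_eq_qFact_mul (i := i) (k := k) qK
  rw [← two_mul_DOne (by omega), ← two_mul_Dpoly hi] at h1
  rw [← two_mul_DOne (by omega)] at h2
  rw [Nat.add_sub_cancel_left]
  have h4 : (2 : K) ≠ 0 := two_ne_zero
  apply mul_left_cancel₀ h4
  apply mul_left_cancel₀ h4
  linear_combination 2 * DOne i qK * qFact k qK * hW + x * qFact k qK * h1
    - 2 * x * Dpoly i sK tK qK * h2

end Recursion

theorem typeD_run_recursion (n : ℕ) (i : ℕ) (hi : 2 ≤ i) (hi' : i ≤ n - 1) (hn : 2 ≤ n) :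
    (Odd i →
      DOne i qK * qFact (n - i) qK * W (Hset n i) =
        tK * Dpoly i sK tK qK * DOne n qK
          + (1 - tK) * (DOne i qK * qFact (n - i) qK * W (Hset n (i - 1))))
    ∧
    (Even i →
      DOne i qK * qFact (n - i) qK * W (Hset n i) =
        sK * Dpoly i sK tK qK * DOne n qK
          + (1 - sK) * (DOne i qK * qFact (n - i) qK * W (Hset n (i - 1)))) :=
  ⟨fun h => run_recursion hi hi' hn tK (if_pos h).symm,
    fun h => run_recursion hi hi' hn sK (if_neg (Nat.not_odd_iff_even.2 h)).symm⟩

end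
end
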